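/- arXiv:1604.00902 — 5 statements merged into one kernel-verified Lean document; each statement's English description precedes it below -/
import Mathlib

section
/- For any two interval numbers γ₁ = (a, b) and γ₂ = (c, d) with 0 ≤ a ≤ b ≤ 1 and 0 ≤ c ≤ d ≤ 1, the componentwise union of γ₁ ⊕ γ₂ and γ₁ O₁ γ₂ equals γ₁ ⊕ γ₂, i.e. componentwise max(γ₁ ⊕ γ₂, γ₁ O₁ γ₂) = γ₁ ⊕ γ₂. -/
/-- Ring sum of interval numbers: `(a, b) ⊕ (c, d) = (a + c - a*c, b + d - b*d)`. -/
def ringSum (g1 g2 : ℝ × ℝ) : ℝ × ℝ := (g1.1 + g2.1 - g1.1 * g2.1, g1.2 + g2.2 - g1.2 * g2.2)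

/-- Componentwise intersection (minimum) of interval numbers. -/
def intvInter (g1 g2 : ℝ × ℝ) : ℝ × ℝ := (min g1.1 g2.1, min g1.2 g2.2)

/-- Componentwise union (maximum) of interval numbers. -/
def intvUnion (g1 g2 : ℝ × ℝ) : ℝ × ℝ := (max g1.1 g2.1, max g1.2 g2.2)

/-- The operator `O₁`: `(a,b) O₁ (c,d) = (|a-c|/(1+|a-c|), |b-d|/(1+|b-d|))`. -/
noncomputable def opO1 (g1 g2 : ℝ × ℝ) : ℝ × ℝ :=
  (|g1.1 - g2.1| / (1 + |g1.1 - g2.1|), |g1.2 - g2.2| / (1 + |g1.2 - g2.2|))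

theorem abs_sub_div_one_add_le {x y : ℝ} (hx0 : 0 ≤ x) (hx1 : x ≤ 1) (hy0 : 0 ≤ y)
    (hy1 : y ≤ 1) : |x - y| / (1 + |x - y|) ≤ x + y - x * y := by
  refine (div_le_self (abs_nonneg _) (le_add_of_nonneg_right (abs_nonneg _))).trans ?_
  rw [abs_le]
  constructor <;> nlinarith [mul_nonneg hx0 (sub_nonneg.2 hy1), mul_nonneg hy0 (sub_nonneg.2 hx1)]

theorem ringSum_union_opO1 (a b c d : ℝ)
    (ha : 0 ≤ a) (hab : a ≤ b) (hb : b ≤ 1)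
    (hc : 0 ≤ c) (hcd : c ≤ d) (hd : d ≤ 1) :
    intvUnion (ringSum (a, b) (c, d)) (opO1 (a, b) (c, d)) = ringSum (a, b) (c, d) := by
  exact Prod.ext
    (max_eq_left (abs_sub_div_one_add_le ha (hab.trans hb) hc (hcd.trans hd)))
    (max_eq_left (abs_sub_div_one_add_le (ha.trans hab) hb (hc.trans hcd) hd))
end

section
/- For any two interval numbers γ₁ = (a, b) and γ₂ = (c, d) with 0 ≤ a ≤ b ≤ 1 and 0 ≤ c ≤ d ≤ 1, the componentwise intersection of γ₁ ⊕ γ₂ and γ₁ O₃ γ₂ equals γ₁ O₃ γ₂, i.e. componentwise min(γ₁ ⊕ γ₂, γ₁ O₃ γ₂) = γ₁ O₃ γ₂. -/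
/-- The operator `O₃`: `(a,b) O₃ (c,d) = (|a-c|/2, |b-d|/2)`. -/
noncomputable def opO3 (g1 g2 : ℝ × ℝ) : ℝ × ℝ := (|g1.1 - g2.1| / 2, |g1.2 - g2.2| / 2)

/-- Half the distance between two points of the unit interval is at most their ring sum. -/
theorem abs_sub_div_two_le_add_sub_mul {x y : ℝ} (hx : 0 ≤ x) (hx1 : x ≤ 1) (hy : 0 ≤ y)
    (hy1 : y ≤ 1) : |x - y| / 2 ≤ x + y - x * y := by
  have h1 := mul_nonneg hx (sub_nonneg.2 hy1)
  have h2 := mul_nonneg hy (sub_nonneg.2 hx1)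
  have h : |x - y| ≤ 2 * (x + y - x * y) := abs_le.2 ⟨by linarith, by linarith⟩
  linarith

theorem ringSum_inter_opO3 (a b c d : ℝ)
    (ha : 0 ≤ a) (hab : a ≤ b) (hb : b ≤ 1)
    (hc : 0 ≤ c) (hcd : c ≤ d) (hd : d ≤ 1) :
    intvInter (ringSum (a, b) (c, d)) (opO3 (a, b) (c, d)) = opO3 (a, b) (c, d) := by
  exact Prod.ext
    (min_eq_right (abs_sub_div_two_le_add_sub_mul ha (hab.trans hb) hc (hcd.trans hd)))
    (min_eq_right (abs_sub_div_two_le_add_sub_mul (ha.trans hab) hb (hc.trans hcd) hd))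
end

section
/- For any two interval numbers γ₁ = (a, b) and γ₂ = (c, d) with 0 ≤ a ≤ b ≤ 1 and 0 ≤ c ≤ d ≤ 1, the componentwise intersection of γ₁ ⊕ γ₂ and γ₁ O₄ γ₂ equals γ₁ O₄ γ₂, i.e. componentwise min(γ₁ ⊕ γ₂, γ₁ O₄ γ₂) = γ₁ O₄ γ₂. -/
/-- The star operation on reals: `x ∗ y = (x + y) / (2 * (x * y + 1))`. -/
noncomputable def star (x y : ℝ) : ℝ := (x + y) / (2 * (x * y + 1))

/-- The operator `O₄`: `(a,b) O₄ (c,d) = ((a ∗ c)/2, (b ∗ d)/2)`. -/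
noncomputable def opO4 (g1 g2 : ℝ × ℝ) : ℝ × ℝ := (star g1.1 g2.1 / 2, star g1.2 g2.2 / 2)

theorem star_half_le_add_sub_mul {x y : ℝ} (hx : 0 ≤ x) (hx1 : x ≤ 1) (hy : 0 ≤ y)
    (hy1 : y ≤ 1) : _root_.star x y / 2 ≤ x + y - x * y := by
  have hxy : 0 ≤ x * y := mul_nonneg hx hy
  have hstar : _root_.star x y ≤ x + y :=
    div_le_self (add_nonneg hx hy) (by linarith)
  have hmulx : x * y ≤ x := mul_le_of_le_one_right hx hy1
  have hmuly : x * y ≤ y := mul_le_of_le_one_left hy hx1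
  linarith

theorem ringSum_inter_opO4 (a b c d : ℝ)
    (ha : 0 ≤ a) (hab : a ≤ b) (hb : b ≤ 1)
    (hc : 0 ≤ c) (hcd : c ≤ d) (hd : d ≤ 1) :
    intvInter (ringSum (a, b) (c, d)) (opO4 (a, b) (c, d)) = opO4 (a, b) (c, d) := by
  exact Prod.ext
    (min_eq_right (star_half_le_add_sub_mul ha (hab.trans hb) hc (hcd.trans hd)))
    (min_eq_right (star_half_le_add_sub_mul (ha.trans hab) hb (hc.trans hcd) hd))
end

section
/- For any two interval numbers γ₁ = (a, b) and γ₂ = (c, d) with 0 ≤ a ≤ b ≤ 1 and 0 ≤ c ≤ d ≤ 1, the componentwise union of γ₁ ⊕ γ₂ and γ₁ O₄ γ₂ equals γ₁ ⊕ γ₂, i.e. componentwise max(γ₁ ⊕ γ₂, γ₁ O₄ γ₂) = γ₁ ⊕ γ₂. -/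
theorem star_div_two_le {x y : ℝ} (hx0 : 0 ≤ x) (hx1 : x ≤ 1) (hy0 : 0 ≤ y) (hy1 : y ≤ 1) :
    star x y / 2 ≤ x + y - x * y := by
  have hxy : 0 ≤ x * y := mul_nonneg hx0 hy0
  have hstar : star x y ≤ (x + y) / 2 := by
    unfold _root_.star
    exact div_le_div_of_nonneg_left (by linarith) two_pos (by linarith)
  have hxy_le : x * y ≤ x := mul_le_of_le_one_right hx0 hy1
  have hyx_le : x * y ≤ y := mul_le_of_le_one_left hy0 hx1
  linarith

theorem ringSum_union_opO4 (a b c d : ℝ)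
    (ha : 0 ≤ a) (hab : a ≤ b) (hb : b ≤ 1)
    (hc : 0 ≤ c) (hcd : c ≤ d) (hd : d ≤ 1) :
    intvUnion (ringSum (a, b) (c, d)) (opO4 (a, b) (c, d)) = ringSum (a, b) (c, d) := by
  exact Prod.ext
    (max_eq_left (star_div_two_le ha (hab.trans hb) hc (hcd.trans hd)))
    (max_eq_left (star_div_two_le (ha.trans hab) hb (hc.trans hcd) hd))
end

section
/- For any three interval numbers γ₁ = (a, b), γ₂ = (c, d), γ₃ = (e, f) with components in [0, 1] and lower endpoint at most upper endpoint, the operator O₄ distributes over the componentwise union: (γ₁ ⊔ γ₂) O₄ γ₃ = (γ₁ O₄ γ₃) ⊔ (γ₂ O₄ γ₃), where ⊔ denotes componentwise maximum. Equivalently, for all x, y, z ∈ [0, 1], (max(x, y) ∗ z)/2 = max((x ∗ z)/2, (y ∗ z)/2). -/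
theorem star_le_star_left {x y z : ℝ} (hx : 0 ≤ x) (hxy : x ≤ y) (hz : 0 ≤ z) (hz1 : z ≤ 1) :
    _root_.star x z ≤ _root_.star y z := by
  have hxz : 0 ≤ x * z := mul_nonneg hx hz
  have hyz : 0 ≤ y * z := mul_nonneg (hx.trans hxy) hz
  unfold _root_.star
  rw [div_le_div_iff₀ (by linarith) (by linarith)]
  nlinarith [mul_nonneg (sub_nonneg.2 hxy) (mul_nonneg (sub_nonneg.2 hz1) (by linarith : 0 ≤ 1 + z))]

theorem star_max_half {x y z : ℝ} (hx : 0 ≤ x) (hy : 0 ≤ y) (hz : 0 ≤ z) (hz1 : z ≤ 1) :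
    _root_.star (max x y) z / 2 = max (_root_.star x z / 2) (_root_.star y z / 2) := by
  rcases le_total x y with h | h
  · have := star_le_star_left hx h hz hz1
    rw [max_eq_right h, max_eq_right (by linarith)]
  · have := star_le_star_left hy h hz hz1
    rw [max_eq_left h, max_eq_left (by linarith)]

theorem opO4_distrib_union (a b c d e f : ℝ)
    (ha : 0 ≤ a) (hab : a ≤ b) (hb : b ≤ 1)
    (hc : 0 ≤ c) (hcd : c ≤ d) (hd : d ≤ 1)
    (he : 0 ≤ e) (hef : e ≤ f) (hf : f ≤ 1) :
    opO4 (intvUnion (a, b) (c, d)) (e, f) =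
      intvUnion (opO4 (a, b) (e, f)) (opO4 (c, d) (e, f)) := by
  exact Prod.ext (star_max_half ha hc he (hef.trans hf))
    (star_max_half (ha.trans hab) (hc.trans hcd) (he.trans hef) hf)
end
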